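/- Suppose n ≥ 3. In H(e,e,n), for all a₂ ∈ Λ₂ and a₃ ∈ Λ₃, the element s₃·(a₂a₃) belongs to Span(Λ₂Λ₃). -/

import Mathlib

noncomputable section

open scoped Pointwise

/-- The base ring `R₀ = ℤ[a]`. -/
abbrev R0 : Type := Polynomial ℤ

/-- The variable `a ∈ R₀`. -/
def aP : R0 := Polynomial.X

/-- Generators of the Corran–Picantin presentation: `t_i` for `i ∈ ℤ/eℤ` and
`s_j` for `3 ≤ j ≤ n`. -/
inductive HGen (e n : ℕ) : Type
  | t : ZMod e → HGen e n
  | s : (j : ℕ) → 3 ≤ j → j ≤ n → HGen e n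

open FreeAlgebra

/-- The free `R₀`-algebra on the generators. -/
abbrev FA (e n : ℕ) : Type := FreeAlgebra R0 (HGen e n)

/-- The defining relations of the Hecke algebra `H(e,e,n)`. -/
inductive HRel (e n : ℕ) : FA e n → FA e n → Prop
  | tt (i j : ZMod e) :
      HRel e n (ι R0 (HGen.t i) * ι R0 (HGen.t (i - 1)))
               (ι R0 (HGen.t j) * ι R0 (HGen.t (j - 1)))
  | tst (i : ZMod e) (h : 3 ≤ n) :
      HRel e n (ι R0 (HGen.t i) * ι R0 (HGen.s 3 le_rfl h) * ι R0 (HGen.t i))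
               (ι R0 (HGen.s 3 le_rfl h) * ι R0 (HGen.t i) * ι R0 (HGen.s 3 le_rfl h))
  | st (i : ZMod e) (j : ℕ) (h3 : 3 ≤ j) (h4 : 4 ≤ j) (hn : j ≤ n) :
      HRel e n (ι R0 (HGen.s j h3 hn) * ι R0 (HGen.t i))
               (ι R0 (HGen.t i) * ι R0 (HGen.s j h3 hn))
  | braid (i : ℕ) (h3 : 3 ≤ i) (h3' : 3 ≤ i + 1) (hn' : i ≤ n) (hn : i + 1 ≤ n) :
      HRel e n (ι R0 (HGen.s i h3 hn') * ι R0 (HGen.s (i + 1) h3' hn) * ι R0 (HGen.s i h3 hn'))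
               (ι R0 (HGen.s (i + 1) h3' hn) * ι R0 (HGen.s i h3 hn') * ι R0 (HGen.s (i + 1) h3' hn))
  | comm (i j : ℕ) (h3i : 3 ≤ i) (hni : i ≤ n) (h3j : 3 ≤ j) (hnj : j ≤ n)
      (hij : i + 1 < j ∨ j + 1 < i) :
      HRel e n (ι R0 (HGen.s i h3i hni) * ι R0 (HGen.s j h3j hnj))
               (ι R0 (HGen.s j h3j hnj) * ι R0 (HGen.s i h3i hni))
  | tq (i : ZMod e) :
      HRel e n (ι R0 (HGen.t i) * ι R0 (HGen.t i))
               (algebraMap R0 (FA e n) aP * ι R0 (HGen.t i) + 1)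
  | sq (j : ℕ) (h3 : 3 ≤ j) (hn : j ≤ n) :
      HRel e n (ι R0 (HGen.s j h3 hn) * ι R0 (HGen.s j h3 hn))
               (algebraMap R0 (FA e n) aP * ι R0 (HGen.s j h3 hn) + 1)

/-- The Hecke algebra `H(e,e,n)`. -/
abbrev Hecke (e n : ℕ) : Type := RingQuot (HRel e n)

/-- The generator `t_i` of `H(e,e,n)`. -/
def tH (e n : ℕ) (i : ZMod e) : Hecke e n :=
  RingQuot.mkAlgHom R0 (HRel e n) (ι R0 (HGen.t i))

/-- The generator `s_j` of `H(e,e,n)` (junk value `1` when `j` is out of range). -/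
def sH (e n : ℕ) (j : ℕ) : Hecke e n :=
  if h : 3 ≤ j ∧ j ≤ n then RingQuot.mkAlgHom R0 (HRel e n) (ι R0 (HGen.s j h.1 h.2)) else 1

/-- Decreasing-index product `s_m s_{m-1} ⋯ s_{i'}` (empty when `m < i'`). -/
def sDescH (e n m i' : ℕ) : Hecke e n :=
  (((List.range' i' (m + 1 - i')).reverse).map (sH e n)).prod

/-- Increasing-index product `s_{i'} s_{i'+1} ⋯ s_m` (empty when `m < i'`). -/
def sAscH (e n i' m : ℕ) : Hecke e n :=
  ((List.range' i' (m + 1 - i')).map (sH e n)).prod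

/-- `Λ₂ = {1} ∪ {t_k : 0 ≤ k ≤ e-1} ∪ {t_k t₀ : 1 ≤ k ≤ e-1}` in `H(e,e,n)`. -/
def Lam2 (e n : ℕ) : Set (Hecke e n) :=
  {1} ∪ {x | ∃ k < e, x = tH e n (k : ZMod e)} ∪
    {x | ∃ k, 1 ≤ k ∧ k < e ∧ x = tH e n (k : ZMod e) * tH e n 0}

/-- `Λ_m = {1} ∪ {s_m ⋯ s_{i'} : 3 ≤ i' ≤ m} ∪ {s_m ⋯ s₃ t_k : 0 ≤ k ≤ e-1}
∪ {s_m ⋯ s₃ t_k s₂ s₃ ⋯ s_{i'} : 1 ≤ k ≤ e-1, 2 ≤ i' ≤ m}` in `H(e,e,n)`,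
where `s₂ = t₀`. -/
def LamH (e n m : ℕ) : Set (Hecke e n) :=
  {1} ∪ {x | ∃ i', 3 ≤ i' ∧ i' ≤ m ∧ x = sDescH e n m i'} ∪
    {x | ∃ k < e, x = sDescH e n m 3 * tH e n (k : ZMod e)} ∪
    {x | ∃ k, 1 ≤ k ∧ k < e ∧ ∃ i', 2 ≤ i' ∧ i' ≤ m ∧
      x = sDescH e n m 3 * tH e n (k : ZMod e) * tH e n 0 * sAscH e n 3 i'}



section Abstract

variable {R H : Type*} [CommRing R] [Ring H] [Algebra R H] {e : ℕ} [NeZero e]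

/-- An additively stable property of `ZMod e`: stepping by one reaches everything. -/
theorem zmod_reach (P : ZMod e → Prop) (i : ZMod e) (h0 : P i)
    (hs : ∀ j, P j → P (j + 1)) (j : ZMod e) : P j := by
  have key : ∀ m : ℕ, P (i + m) := by
    intro m
    induction m with
    | zero => simpa using h0
    | succ k ih =>
      have := hs _ ih
      rw [add_assoc] at this
      exact_mod_cast this
  have := key (j - i).val
  simpa using this

/-- Shift formula `t_k t_l = t_{k+1} t_{l+1} + a t_k - a t_{l+1}`. -/
theorem t_shift (a : R) (t : ZMod e → H)
    (htt : ∀ i j, t i * t (i - 1) = t j * t (j - 1))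
    (htq : ∀ i, t i * t i = a • t i + 1) (k l : ZMod e) :
    t k * t l = t (k + 1) * t (l + 1) + a • t k - a • t (l + 1) := by
  have hD : t (k + 1) * t k = t (l + 1) * t l := by
    have := htt (k + 1) (l + 1)
    simpa using this
  have h1 : t (k + 1) * (t (k + 1) * t k) = a • (t (k + 1) * t k) + t k := by
    rw [← mul_assoc, htq, add_mul, one_mul, smul_mul_assoc]
  have h2 : t (l + 1) * t l * t l = a • (t (l + 1) * t l) + t (l + 1) := by
    rw [mul_assoc, htq, mul_add, mul_one, mul_smul_comm]
  have hk : t k = t (k + 1) * (t (l + 1) * t l) - a • (t (l + 1) * t l) := by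
    rw [← hD, h1]; abel
  have h3 : t k * t l = t (k + 1) * (t (l + 1) * t l * t l) - a • (t (l + 1) * t l * t l) := by
    conv_lhs => rw [hk]
    rw [sub_mul, smul_mul_assoc, mul_assoc (t (k + 1))]
  rw [h3, h2, mul_add, mul_smul_comm, ← hD, h1]
  simp only [smul_add]
  abel

/-- The span of `1`, the `t_m` and the `t_k t_l` with `l` fixed. -/
def Bsp (R : Type*) {H : Type*} [CommRing R] [Ring H] [Algebra R H] {e : ℕ}
    (t : ZMod e → H) (l : ZMod e) : Submodule R H :=
  Submodule.span R ({1} ∪ Set.range t ∪ Set.range (fun k => t k * t l))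

theorem one_mem_Bsp (t : ZMod e → H) (l : ZMod e) : 1 ∈ Bsp R t l :=
  Submodule.subset_span (by simp)

theorem t_mem_Bsp (t : ZMod e → H) (l m : ZMod e) : t m ∈ Bsp R t l :=
  Submodule.subset_span (by simp)

theorem tt_mem_Bsp (a : R) (t : ZMod e → H)
    (htt : ∀ i j, t i * t (i - 1) = t j * t (j - 1))
    (htq : ∀ i, t i * t i = a • t i + 1) (l i j : ZMod e) :
    t i * t j ∈ Bsp R t l := by
  refine zmod_reach (e := e) (fun j => ∀ i, t i * t j ∈ Bsp R t l) l ?_ ?_ j i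
  · intro i
    exact Submodule.subset_span (by simp)
  · intro j hj i
    have h := t_shift a t htt htq (i - 1) j
    rw [sub_add_cancel] at h
    have h' : t i * t (j + 1) = t (i - 1) * t j - a • t (i - 1) + a • t (j + 1) := by
      rw [h]; abel
    rw [h']
    exact add_mem (sub_mem (hj _) (Submodule.smul_mem _ _ (t_mem_Bsp _ _ _)))
      (Submodule.smul_mem _ _ (t_mem_Bsp _ _ _))

theorem Bsp_le (a : R) (t : ZMod e → H)
    (htt : ∀ i j, t i * t (i - 1) = t j * t (j - 1))
    (htq : ∀ i, t i * t i = a • t i + 1) (l m : ZMod e) :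
    Bsp R t l ≤ Bsp R t m := by
  refine Submodule.span_le.2 ?_
  rintro x ((rfl | ⟨k, rfl⟩) | ⟨k, rfl⟩)
  · exact one_mem_Bsp _ _
  · exact t_mem_Bsp _ _ _
  · exact tt_mem_Bsp a t htt htq _ _ _

theorem Bsp_mul_t (a : R) (t : ZMod e → H)
    (htt : ∀ i j, t i * t (i - 1) = t j * t (j - 1))
    (htq : ∀ i, t i * t i = a • t i + 1) (l m : ZMod e) (x : H) (hx : x ∈ Bsp R t l) :
    x * t m ∈ Bsp R t l := by
  have hx' := Bsp_le a t htt htq l m hx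
  refine Bsp_le a t htt htq m l ?_
  refine Submodule.span_induction (p := fun x _ => x * t m ∈ Bsp R t m) ?_ ?_ ?_ ?_ hx'
  · rintro x ((rfl | ⟨k, rfl⟩) | ⟨k, rfl⟩)
    · rw [one_mul]; exact t_mem_Bsp _ _ _
    · exact tt_mem_Bsp a t htt htq _ _ _
    · change t k * t m * t m ∈ _
      rw [mul_assoc, htq, mul_add, mul_one, mul_smul_comm]
      exact add_mem (Submodule.smul_mem _ _ (tt_mem_Bsp a t htt htq _ _ _)) (t_mem_Bsp _ _ _)
  · simp
  · intro x y _ _ h1 h2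
    rw [add_mul]; exact add_mem h1 h2
  · intro c x _ h1
    rw [smul_mul_assoc]; exact Submodule.smul_mem _ _ h1

theorem Bsp_mul (a : R) (t : ZMod e → H)
    (htt : ∀ i j, t i * t (i - 1) = t j * t (j - 1))
    (htq : ∀ i, t i * t i = a • t i + 1) (l : ZMod e) (x y : H) (hx : x ∈ Bsp R t l)
    (hy : y ∈ Bsp R t l) : x * y ∈ Bsp R t l := by
  refine Submodule.span_induction (p := fun y _ => x * y ∈ Bsp R t l) ?_ ?_ ?_ ?_ hy
  · rintro y ((rfl | ⟨k, rfl⟩) | ⟨k, rfl⟩)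
    · rwa [mul_one]
    · exact Bsp_mul_t a t htt htq _ _ _ hx
    · change x * (t k * t l) ∈ _
      rw [← mul_assoc]
      exact Bsp_mul_t a t htt htq _ _ _ (Bsp_mul_t a t htt htq _ _ _ hx)
  · simp
  · intro x y _ _ h1 h2
    rw [mul_add]; exact add_mem h1 h2
  · intro c x _ h1
    rw [mul_smul_comm]; exact Submodule.smul_mem _ _ h1

/-- The module `M = A Λ₃` (with `A = Bsp R t 0`) contains `A` and `A s A`, contains `s t_k t₀ s`,
and is right-stable under the generators. -/
theorem stable_aux (a : R) (t : ZMod e → H) (s : H)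
    (htt : ∀ i j, t i * t (i - 1) = t j * t (j - 1))
    (htq : ∀ i, t i * t i = a • t i + 1)
    (hsq : s * s = a • s + 1)
    (hb : ∀ i, t i * s * t i = s * t i * s)
    (L2 L3 : Set H) (hL2 : Submodule.span R L2 = Bsp R t 0)
    (h1 : 1 ∈ L3) (hs : s ∈ L3) (hst : ∀ k, s * t k ∈ L3)
    (hstt : ∀ k, k ≠ 0 → s * t k * t 0 ∈ L3)
    (hstts : ∀ k, k ≠ 0 → s * t k * t 0 * s ∈ L3)
    (hL3 : ∀ x ∈ L3, x = 1 ∨ x = s ∨ (∃ k, x = s * t k) ∨ (∃ k, x = s * t k * t 0) ∨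
      ∃ k, x = s * t k * t 0 * s) (x y : H) (hx : x ∈ L2) (hy : y ∈ L3) :
    s * (x * y) ∈ Submodule.span R (L2 * L3) := by
  set A := Bsp R t 0 with hA
  have Aone : (1 : H) ∈ A := one_mem_Bsp _ _
  have At : ∀ k, t k ∈ A := fun k => t_mem_Bsp _ _ _
  have Amul : ∀ x y, x ∈ A → y ∈ A → x * y ∈ A := fun x y => Bsp_mul a t htt htq 0 x y
  rw [← Submodule.span_mul_span, hL2]
  set M := A * Submodule.span R L3 with hM
  have AM : ∀ x m, x ∈ A → m ∈ M → x * m ∈ M := by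
    intro x m hx hm
    have h : A * M ≤ M := by
      rw [hM, ← mul_assoc]
      exact mul_le_mul_left (Submodule.mul_le.2 fun x hx y hy => Amul x y hx hy) _
    exact h (Submodule.mul_mem_mul hx hm)
  have L3M : ∀ y ∈ L3, y ∈ M := by
    intro y hy
    have := Submodule.mul_mem_mul Aone (Submodule.subset_span (R := R) hy)
    rwa [one_mul] at this
  have indM : ∀ u : H, (∀ y ∈ L3, y * u ∈ M) → ∀ m ∈ M, m * u ∈ M := by
    intro u hu m hm
    refine Submodule.mul_induction_on hm ?_ ?_
    · intro x hx y hy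
      rw [mul_assoc]
      refine AM _ _ hx ?_
      refine Submodule.span_induction (p := fun y _ => y * u ∈ M) hu ?_ ?_ ?_ hy
      · simp
      · intro x y _ _ h1 h2
        rw [add_mul]; exact add_mem h1 h2
      · intro c x _ h1
        rw [smul_mul_assoc]; exact Submodule.smul_mem _ _ h1
    · intro x y h1 h2
      rw [add_mul]; exact add_mem h1 h2
  -- induction over `A` in the form `Bsp l`
  have indA : ∀ (l : ZMod e) (u v : H), u * v ∈ M → (∀ k, u * t k * v ∈ M) →
      (∀ k, u * (t k * t l) * v ∈ M) → ∀ x ∈ A, u * x * v ∈ M := by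
    intro l u v h1 h2 h3 x hx
    have hx' := Bsp_le a t htt htq 0 l hx
    refine Submodule.span_induction (p := fun x _ => u * x * v ∈ M) ?_ ?_ ?_ ?_ hx'
    · rintro x ((rfl | ⟨k, rfl⟩) | ⟨k, rfl⟩)
      · rwa [mul_one]
      · exact h2 k
      · exact h3 k
    · simp
    · intro x y _ _ h1 h2
      rw [mul_add, add_mul]; exact add_mem h1 h2
    · intro c x _ h1
      rw [mul_smul_comm, smul_mul_assoc]; exact Submodule.smul_mem _ _ h1
  have M1 : ∀ x ∈ A, x ∈ M := by
    intro x hx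
    have := AM x 1 hx (L3M _ h1)
    rwa [mul_one] at this
  have M2 : ∀ x ∈ A, s * x ∈ M := by
    intro x hx
    have := indA 0 s 1 (by rw [mul_one]; exact L3M _ hs)
      (fun k => by rw [mul_one]; exact L3M _ (hst k)) (fun k => by
        rw [mul_one]
        by_cases hk : k = 0
        · subst hk
          rw [htq, mul_add, mul_one, mul_smul_comm]
          exact add_mem (Submodule.smul_mem _ _ (L3M _ (hst 0))) (L3M _ hs)
        · rw [← mul_assoc]; exact L3M _ (hstt k hk)) x hx
    rwa [mul_one] at this
  have Mss : s * s ∈ M := by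
    rw [hsq]; exact add_mem (Submodule.smul_mem _ _ (L3M _ hs)) (L3M _ h1)
  have Msts : ∀ k, s * t k * s ∈ M := by
    intro k
    rw [← hb, mul_assoc]
    exact AM _ _ (At k) (L3M _ (hst k))
  have M3 : ∀ x ∈ A, s * x * s ∈ M := by
    refine indA 0 s s Mss Msts ?_
    intro k
    by_cases hk : k = 0
    · subst hk
      rw [htq, mul_add, mul_one, mul_smul_comm, add_mul, smul_mul_assoc]
      exact add_mem (Submodule.smul_mem _ _ (Msts 0)) Mss
    · rw [← mul_assoc]; exact L3M _ (hstts k hk)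
  have M4 : ∀ l, ∀ x ∈ A, s * x * (s * t l) ∈ M := by
    intro l
    refine indA l s (s * t l) ?_ ?_ ?_
    · rw [← mul_assoc, hsq, add_mul, one_mul, smul_mul_assoc]
      exact add_mem (Submodule.smul_mem _ _ (L3M _ (hst l))) (M1 _ (At l))
    · intro k
      rw [← mul_assoc, ← hb, mul_assoc, mul_assoc]
      exact AM _ _ (At k) (M2 _ (Amul _ _ (At k) (At l)))
    · intro k
      have : s * (t k * t l) * (s * t l) = t k * (s * (t k * t l) * s) := by
        calc s * (t k * t l) * (s * t l) = s * t k * (t l * s * t l) := by noncomm_ring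
          _ = (s * t k * s) * t l * s := by rw [hb]; noncomm_ring
          _ = _ := by rw [← hb]; noncomm_ring
      rw [this]
      exact AM _ _ (At k) (M3 _ (Amul _ _ (At k) (At l)))
  have Mt : ∀ l, ∀ m ∈ M, m * t l ∈ M := by
    intro l
    refine indM _ ?_
    intro y hy
    rcases hL3 y hy with rfl | rfl | ⟨k, rfl⟩ | ⟨k, rfl⟩ | ⟨k, rfl⟩
    · rw [one_mul]; exact M1 _ (At l)
    · exact M2 _ (At l)
    · rw [mul_assoc]; exact M2 _ (Amul _ _ (At k) (At l))
    · rw [mul_assoc, mul_assoc]; exact M2 _ (Amul _ _ (At k) (Amul _ _ (At 0) (At l)))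
    · rw [mul_assoc, mul_assoc s]; exact M4 l _ (Amul _ _ (At k) (At 0))
  have Ms : ∀ m ∈ M, m * s ∈ M := by
    refine indM _ ?_
    intro y hy
    rcases hL3 y hy with rfl | h | ⟨k, rfl⟩ | ⟨k, rfl⟩ | ⟨k, rfl⟩
    · rw [one_mul]; exact L3M _ hs
    · rw [h]; exact Mss
    · exact Msts k
    · rw [mul_assoc s]; exact M3 _ (Amul _ _ (At k) (At 0))
    · rw [mul_assoc, hsq, mul_add, mul_one, mul_smul_comm, mul_assoc s]
      exact add_mem (Submodule.smul_mem _ _ (M3 _ (Amul _ _ (At k) (At 0))))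
        (M2 _ (Amul _ _ (At k) (At 0)))
  have hxA : x ∈ A := by
    rw [← hL2]; exact Submodule.subset_span hx
  have hsx := M2 x hxA
  rw [← mul_assoc]
  rcases hL3 y hy with rfl | h | ⟨k, rfl⟩ | ⟨k, rfl⟩ | ⟨k, rfl⟩
  · rwa [mul_one]
  · rw [h]; exact Ms _ hsx
  · rw [← mul_assoc]; exact Mt _ _ (Ms _ hsx)
  · simp only [← mul_assoc]; exact Mt _ _ (Mt _ _ (Ms _ hsx))
  · simp only [← mul_assoc]; exact Ms _ (Mt _ _ (Mt _ _ (Ms _ hsx)))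

end Abstract

theorem tH_tt (e n : ℕ) (i j : ZMod e) :
    tH e n i * tH e n (i - 1) = tH e n j * tH e n (j - 1) := by
  have := RingQuot.mkAlgHom_rel R0 (HRel.tt (n := n) i j)
  rw [map_mul, map_mul] at this
  exact this

theorem tH_tq (e n : ℕ) (i : ZMod e) :
    tH e n i * tH e n i = aP • tH e n i + 1 := by
  have := RingQuot.mkAlgHom_rel R0 (HRel.tq (n := n) i)
  rw [map_mul, map_add, map_mul, map_one, AlgHom.commutes, ← Algebra.smul_def] at this
  exact this

theorem sH_three (e n : ℕ) (hn : 3 ≤ n) :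
    sH e n 3 = RingQuot.mkAlgHom R0 (HRel e n) (ι R0 (HGen.s 3 le_rfl hn)) := by
  unfold sH
  rw [dif_pos ⟨le_rfl, hn⟩]

theorem sH_sq (e n : ℕ) (hn : 3 ≤ n) :
    sH e n 3 * sH e n 3 = aP • sH e n 3 + 1 := by
  have := RingQuot.mkAlgHom_rel R0 (HRel.sq (e := e) 3 le_rfl hn)
  rw [map_mul, map_add, map_mul, map_one, AlgHom.commutes, ← Algebra.smul_def] at this
  rw [sH_three e n hn]
  exact this

theorem tH_braid (e n : ℕ) (hn : 3 ≤ n) (i : ZMod e) :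
    tH e n i * sH e n 3 * tH e n i = sH e n 3 * tH e n i * sH e n 3 := by
  have := RingQuot.mkAlgHom_rel R0 (HRel.tst i hn)
  rw [map_mul, map_mul, map_mul, map_mul] at this
  rw [sH_three e n hn]
  exact this

theorem span_Lam2 (e n : ℕ) [NeZero e] :
    Submodule.span R0 (Lam2 e n) = Bsp R0 (tH e n) 0 := by
  apply le_antisymm
  · refine Submodule.span_le.2 ?_
    rintro x ((rfl | ⟨k, _, rfl⟩) | ⟨k, _, _, rfl⟩)
    · exact one_mem_Bsp _ _
    · exact t_mem_Bsp _ _ _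
    · exact Submodule.subset_span (Or.inr ⟨_, rfl⟩)
  · have h1 : (1 : Hecke e n) ∈ Submodule.span R0 (Lam2 e n) :=
      Submodule.subset_span (Or.inl (Or.inl rfl))
    have ht : ∀ k, tH e n k ∈ Submodule.span R0 (Lam2 e n) := fun k =>
      Submodule.subset_span (Or.inl (Or.inr ⟨k.val, k.val_lt, by simp⟩))
    refine Submodule.span_le.2 ?_
    rintro x ((rfl | ⟨k, rfl⟩) | ⟨k, rfl⟩)
    · exact h1
    · exact ht k
    · by_cases hk : k = 0
      · subst hk
        change tH e n 0 * tH e n 0 ∈ Submodule.span R0 (Lam2 e n)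
        rw [tH_tq]
        exact add_mem (Submodule.smul_mem _ _ (ht 0)) h1
      · refine Submodule.subset_span (Or.inr ⟨k.val, ?_, k.val_lt, by simp⟩)
        exact Nat.one_le_iff_ne_zero.2 (by simpa using hk)

theorem sDescH_three (e n : ℕ) : sDescH e n 3 3 = sH e n 3 := by
  simp [sDescH, List.range']

theorem sAscH_three_three (e n : ℕ) : sAscH e n 3 3 = sH e n 3 := by
  simp [sAscH, List.range']

theorem sAscH_three_two (e n : ℕ) : sAscH e n 3 2 = 1 := by
  simp [sAscH]

/-- For `n ≥ 3` and all `a₂ ∈ Λ₂`, `a₃ ∈ Λ₃`, the element `s₃·(a₂a₃)` lies in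
`Span(Λ₂Λ₃)`. -/
theorem s3_mul_mem_span (e n : ℕ) (he : 1 ≤ e) (hn : 3 ≤ n)
    (hex : ¬(n = 2 ∧ Even e)) (a2 a3 : Hecke e n)
    (ha2 : a2 ∈ Lam2 e n) (ha3 : a3 ∈ LamH e n 3) :
    sH e n 3 * (a2 * a3) ∈ Submodule.span R0 (Lam2 e n * LamH e n 3) := by
  haveI : NeZero e := ⟨by omega⟩
  have hval : ∀ k : ZMod e, k ≠ 0 → 1 ≤ k.val := fun k hk =>
    Nat.one_le_iff_ne_zero.2 (by simpa using hk)
  refine stable_aux aP (tH e n) (sH e n 3) (tH_tt e n) (tH_tq e n) (sH_sq e n hn)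
    (tH_braid e n hn) (Lam2 e n) (LamH e n 3) (span_Lam2 e n) ?_ ?_ ?_ ?_ ?_ ?_ a2 a3 ha2 ha3
  · exact Or.inl (Or.inl (Or.inl rfl))
  · exact Or.inl (Or.inl (Or.inr ⟨3, le_rfl, le_rfl, (sDescH_three e n).symm⟩))
  · intro k
    exact Or.inl (Or.inr ⟨k.val, k.val_lt, by simp [sDescH_three]⟩)
  · intro k hk
    exact Or.inr ⟨k.val, hval k hk, k.val_lt, 2, le_rfl, by norm_num,
      by simp [sDescH_three, sAscH_three_two]⟩
  · intro k hk
    exact Or.inr ⟨k.val, hval k hk, k.val_lt, 3, by norm_num, le_rfl,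
      by simp [sDescH_three, sAscH_three_three]⟩
  · rintro x (((rfl | ⟨i, h3, h3', rfl⟩) | ⟨k, _, rfl⟩) | ⟨k, _, _, i, h2, h3, rfl⟩)
    · exact Or.inl rfl
    · obtain rfl : i = 3 := le_antisymm h3' h3
      exact Or.inr (Or.inl (sDescH_three e n))
    · exact Or.inr (Or.inr (Or.inl ⟨k, by rw [sDescH_three]⟩))
    · obtain rfl | rfl : i = 2 ∨ i = 3 := by omega
      · exact Or.inr (Or.inr (Or.inr (Or.inl
          ⟨k, by rw [sDescH_three, sAscH_three_two, mul_one]⟩)))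
      · exact Or.inr (Or.inr (Or.inr (Or.inr
          ⟨k, by rw [sDescH_three, sAscH_three_three]⟩)))
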